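/- Let M be an affine scheme of finite type over F_p of positive dimension. Then there exists a power q of p and a point of M with values in the local field F_q((t)) that does not extend to a point with values in the valuation ring F_q[[t]]. -/

import Mathlib

section lemA
variable {O κ : Type*} [CommRing O] [Field κ]

theorem auxTau (p : ℕ) [Fact p.Prime] [CharP O p] (m : ℕ) (hm : m ≠ 0) (π : O)
    (res : O →+* κ) (hsurj : Function.Surjective res) (hker : ∀ a, res a = 0 ↔ π ∣ a) (n : ℕ) :
    ∃ τ : κ →+* O ⧸ Ideal.span {π ^ n},
      ∀ a, τ (res a) = Ideal.Quotient.mk _ (a ^ (p ^ (m * n))) := by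
  have : ExpChar O p := ExpChar.prime Fact.out
  let g : O →+* O ⧸ Ideal.span {π ^ n} :=
    (Ideal.Quotient.mk _).comp (iterateFrobenius O p (m * n))
  have hg : RingHom.ker res ≤ RingHom.ker g := by
    intro a ha
    rw [RingHom.mem_ker, hker] at ha
    rw [RingHom.mem_ker]
    simp only [g, RingHom.comp_apply, iterateFrobenius_def]
    rw [Ideal.Quotient.eq_zero_iff_mem, Ideal.mem_span_singleton]
    refine (pow_dvd_pow_of_dvd ha n).trans (pow_dvd_pow a ?_)
    calc n ≤ m * n := Nat.le_mul_of_pos_left n (Nat.pos_of_ne_zero hm)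
      _ ≤ p ^ (m * n) := (Nat.lt_pow_self (Fact.out : p.Prime).one_lt).le
  refine ⟨RingHom.liftOfSurjective res hsurj ⟨g, hg⟩, fun a => ?_⟩
  rw [RingHom.liftOfSurjective, RingHom.liftOfRightInverse_comp_apply]
  simp [g, iterateFrobenius_def]

theorem lemA [IsDomain O] [IsNoetherianRing O] (p : ℕ) [Fact p.Prime] [CharP O p] (m : ℕ) (hm : m ≠ 0) (π : O)
    (hπ : π ≠ 0)
    (res : O →+* κ) (hsurj : Function.Surjective res) (hker : ∀ a, res a = 0 ↔ π ∣ a)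
    (hq : ∀ x : κ, x ^ (p ^ m) = x) :
    ∃ φ : O →+* PowerSeries κ, Function.Injective φ ∧
      ∀ a, PowerSeries.constantCoeff (φ a) = res a := by
  have hq' : ∀ (n : ℕ) (x : κ), x ^ (p ^ (m * n)) = x := by
    intro n x
    induction n with
    | zero => simp
    | succ n ih => rw [mul_add, mul_one, pow_add, pow_mul, ih, hq]
  choose τ hτ using auxTau (κ := κ) p m hm π res hsurj hker
  let mk : ∀ n, O →+* O ⧸ Ideal.span {π ^ n} := fun n => Ideal.Quotient.mk _
  have hmk : ∀ n a, mk n a = 0 ↔ π ^ n ∣ a := fun n a => by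
    simp only [mk]; rw [Ideal.Quotient.eq_zero_iff_mem, Ideal.mem_span_singleton]
  have hmks : ∀ n, Function.Surjective (mk n) := fun n => Ideal.Quotient.mk_surjective
  let θ : ∀ n, Polynomial κ →+* O ⧸ Ideal.span {π ^ n} :=
    fun n => Polynomial.eval₂RingHom (τ n) (mk n π)
  have θC : ∀ n a, θ n (Polynomial.C (res a)) = mk n (a ^ (p ^ (m * n))) := by
    intro n a; simp [θ, hτ, mk]
  have θX : ∀ n, θ n Polynomial.X = mk n π := by intro n; simp [θ]
  have hcompat : ∀ n (g : Polynomial κ) (a : O), θ (n + 1) g = mk (n + 1) a → θ n g = mk n a := by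
    intro n
    have hle : Ideal.span {π ^ (n + 1)} ≤ Ideal.span {π ^ n} := by
      rw [Ideal.span_singleton_le_span_singleton]; exact pow_dvd_pow _ (Nat.le_succ n)
    have hfac : ∀ a, Ideal.Quotient.factor hle (mk (n + 1) a) = mk n a := fun a => rfl
    have key : (Ideal.Quotient.factor hle).comp (θ (n + 1)) = θ n := by
      apply Polynomial.ringHom_ext
      · intro x
        obtain ⟨a, rfl⟩ := hsurj x
        rw [RingHom.comp_apply, θC, θC, hfac]
        rw [← sub_eq_zero, ← map_sub]
        have h1 : res (a ^ p ^ m) = res a := by rw [map_pow, hq]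
        have h2 := congrArg (τ n) h1
        rw [hτ, hτ, ← pow_mul, ← pow_add] at h2
        rw [map_sub, sub_eq_zero]
        rw [mul_add, mul_one, add_comm]
        exact h2
      · rw [RingHom.comp_apply, θX, θX, hfac]
    intro g a h
    rw [← key, RingHom.comp_apply, h, hfac]
  have hcompat' : ∀ n k (g : Polynomial κ) (a : O), θ (n + k) g = mk (n + k) a →
      θ n g = mk n a := by
    intro n k
    induction k with
    | zero => intro g a h; exact h
    | succ k ih => intro g a h; exact ih g a (hcompat _ g a h)
  have hb : ∀ n (b : O), ∃ c, mk n b = θ n (Polynomial.C (res b)) + mk n (π * c) := by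
    intro n b
    obtain ⟨c, hc⟩ := (hker (b - b ^ (p ^ (m * n)))).1 (by rw [map_sub, map_pow, hq', sub_self])
    refine ⟨c, ?_⟩
    rw [θC, ← map_add, ← hc]; congr 1; ring
  have hex : ∀ n (a : O), ∃ g, θ n g = mk n a := by
    intro n a
    have : ∀ j, ∃ g b, mk n a = θ n g + mk n (π ^ j * b) := by
      intro j
      induction j with
      | zero => exact ⟨0, a, by simp⟩
      | succ j ih =>
        obtain ⟨g, b, h⟩ := ih
        obtain ⟨c, hc⟩ := hb n b
        refine ⟨g + Polynomial.X ^ j * Polynomial.C (res b), c, ?_⟩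
        rw [h, map_mul (mk n), hc, map_add (θ n), map_mul (θ n), map_pow (θ n), θX]
        simp only [map_mul (mk n), map_pow (mk n)]
        ring
    obtain ⟨g, b, h⟩ := this n
    refine ⟨g, ?_⟩
    rw [h, (hmk n (π ^ n * b)).2 (dvd_mul_right _ _), add_zero]
  have hconst : ∀ n (g : Polynomial κ) (c : O), θ (n + 1) g = mk (n + 1) c →
      res c = g.coeff 0 := by
    intro n g c h
    obtain ⟨b, hb⟩ := hsurj (g.coeff 0)
    obtain ⟨d, hd⟩ := hmks (n + 1) (θ (n + 1) g.divX)
    rw [← Polynomial.X_mul_divX_add g, map_add, map_mul, ← hb, θX, θC, ← hd, ← map_mul, ← map_add,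
      ← sub_eq_zero, ← map_sub, hmk] at h
    have h2 := (hker _).2 ((dvd_pow_self π (Nat.succ_ne_zero n)).trans h)
    rw [map_sub, map_add, map_mul, (hker π).2 dvd_rfl, map_pow, hq', zero_mul, zero_add,
      sub_eq_zero] at h2
    rw [← h2, hb]
  have hinj : ∀ n (g : Polynomial κ), θ n g = 0 → Polynomial.X ^ n ∣ g := by
    intro n
    induction n with
    | zero => intro g _; simp
    | succ n ih =>
      intro g hg
      obtain ⟨h, rfl⟩ := ih g (by simpa using hcompat n g 0 (by simpa using hg))
      obtain ⟨c, hc⟩ := hmks (n + 1) (θ (n + 1) h)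
      rw [map_mul, map_pow, θX, ← hc, ← map_pow, ← map_mul, hmk, pow_succ,
        mul_dvd_mul_iff_left (pow_ne_zero n hπ)] at hg
      have := hconst n h c hc.symm
      rw [(hker c).2 hg] at this
      rw [pow_succ]
      exact mul_dvd_mul_left _ (Polynomial.X_dvd_iff.2 this.symm)
  have hXn : ∀ n (g : Polynomial κ), Polynomial.X ^ n ∣ g → θ n g = 0 := by
    rintro n _ ⟨h, rfl⟩
    rw [map_mul, map_pow, θX, ← map_pow, (hmk n _).2 dvd_rfl, zero_mul]
  let Rep : O → PowerSeries κ → Prop := fun a f => ∀ n, θ n (f.trunc n) = mk n a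
  have hexi : ∀ a, ∃ f, Rep a f := by
    intro a
    choose g hg using fun n => hex n a
    refine ⟨PowerSeries.mk fun i => (g (i + 1)).coeff i, fun n => ?_⟩
    rw [← hg n, ← sub_eq_zero, ← map_sub]
    apply hXn
    rw [Polynomial.X_pow_dvd_iff]
    intro d hd
    rw [Polynomial.coeff_sub, PowerSeries.coeff_trunc, if_pos hd, PowerSeries.coeff_mk]
    obtain ⟨k, rfl⟩ := Nat.exists_eq_add_of_le (Nat.succ_le_of_lt hd)
    have h1 := hcompat' (d + 1) k _ _ (hg (d + 1 + k))
    have h2 := hinj (d + 1) (g (d + 1) - g (d + 1 + k)) (by rw [map_sub, hg, h1, sub_self])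
    rw [← Polynomial.coeff_sub]
    exact (Polynomial.X_pow_dvd_iff.1 h2) d (Nat.lt_succ_self d)
  have huniq : ∀ a f f', Rep a f → Rep a f' → f = f' := by
    intro a f f' h h'
    ext n
    have h2 := hinj (n + 1) (f.trunc (n + 1) - f'.trunc (n + 1)) (by rw [map_sub, h, h', sub_self])
    have h3 := (Polynomial.X_pow_dvd_iff.1 h2) n (Nat.lt_succ_self n)
    rw [Polynomial.coeff_sub, PowerSeries.coeff_trunc, PowerSeries.coeff_trunc,
      if_pos (Nat.lt_succ_self n), if_pos (Nat.lt_succ_self n), sub_eq_zero] at h3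
    exact h3
  choose F hF using hexi
  have hmulR : ∀ a b, Rep (a * b) (F a * F b) := by
    intro a b n
    rw [map_mul (mk n), ← hF a n, ← hF b n, ← map_mul (θ n), ← sub_eq_zero, ← map_sub]
    apply hXn
    rw [Polynomial.X_pow_dvd_iff]
    intro d hd
    rw [← PowerSeries.trunc_trunc_mul_trunc, Polynomial.coeff_sub, PowerSeries.coeff_trunc,
      if_pos hd, ← Polynomial.coe_mul, Polynomial.coeff_coe, sub_self]
  have hF1 : Rep 1 1 := by
    intro n
    cases n with
    | zero =>
      have : mk 0 1 = 0 := (hmk 0 1).2 (by simp)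
      have h2 : ∀ z : O ⧸ Ideal.span {π ^ 0}, z = 0 := by
        intro z
        rw [← mul_one z, ← map_one (mk 0), this, mul_zero]
      rw [h2 (mk 0 1), h2 (θ 0 _)]
    | succ n => rw [PowerSeries.trunc_one, map_one, map_one]
  let φ : O →+* PowerSeries κ :=
    { toFun := F
      map_one' := huniq 1 _ _ (hF 1) hF1
      map_mul' := fun a b => huniq _ _ _ (hF (a * b)) (hmulR a b)
      map_zero' := huniq 0 _ _ (hF 0) (fun n => by simp)
      map_add' := fun a b => huniq _ _ _ (hF (a + b)) (fun n => by
        rw [map_add, map_add, map_add, hF, hF]) }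
  refine ⟨φ, ?_, ?_⟩
  · rw [injective_iff_map_eq_zero]
    intro a ha
    have ha' : F a = 0 := ha
    by_contra hne
    have hnu : ¬ IsUnit π := by
      intro hu
      have := (hker 1).2 (hu.dvd)
      simp at this
    have hfin : FiniteMultiplicity π a := FiniteMultiplicity.of_not_isUnit hnu hne
    obtain ⟨n, hn⟩ := hfin
    apply hn
    rw [← hmk, ← hF a, ha']
    simp
  · intro a
    have := hconst 0 _ a (hF a 1)
    rw [this, PowerSeries.coeff_trunc]
    simp [φ]
end lemA

theorem lemB1 (p : ℕ) [Fact p.Prime] (C L : Type*) [CommRing C] [IsDedekindDomain C] [Field L]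
    [Algebra C L] [IsFractionRing C L] [CharP C p] (Q : Ideal C) [hQ : Q.IsPrime] (hQ0 : Q ≠ ⊥)
    [hCQ : Finite (C ⧸ Q)] :
    ∃ m : ℕ, m ≠ 0 ∧ ∃ φ : L →+* LaurentSeries (GaloisField p m), ∀ x ∈ Q,
      ∃ Y : PowerSeries (GaloisField p m), PowerSeries.constantCoeff Y = 0 ∧
        φ (algebraMap C L x) = HahnSeries.ofPowerSeries ℤ _ Y := by
  have hQmax : Q.IsMaximal := hQ.isMaximal hQ0
  let O := Localization.AtPrime Q
  have hO : IsDiscreteValuationRing O :=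
    IsLocalization.AtPrime.isDiscreteValuationRing_of_dedekind_domain C hQ0 O
  let κ := O ⧸ IsLocalRing.maximalIdeal O
  let : Field κ := Ideal.Quotient.field _
  have hκ : Finite κ := Finite.of_equiv _
    (IsLocalization.AtPrime.equivQuotMaximalIdeal Q O).toEquiv
  have hCO : Function.Injective (algebraMap C O) :=
    IsLocalization.injective O (Ideal.primeCompl_le_nonZeroDivisors Q)
  have hcO : CharP O p := charP_of_injective_algebraMap hCO p
  have hcκ : CharP κ p := by
    have : p.Prime := Fact.out
    refine (CharP.charP_iff_prime_eq_zero this).2 ?_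
    have h0 : (p : O) = 0 := CharP.cast_eq_zero O p
    have h1 : (p : κ) = Ideal.Quotient.mk (IsLocalRing.maximalIdeal O) (p : O) :=
      (map_natCast _ _).symm
    rw [h1, h0, map_zero]
  let : Fintype κ := Fintype.ofFinite κ
  obtain ⟨m, hm, hcard⟩ := FiniteField.card κ p
  have hm0 : (m : ℕ) ≠ 0 := m.ne_zero
  refine ⟨m, hm0, ?_⟩
  let : Fintype (GaloisField p m) := Fintype.ofFinite _
  have e : κ ≃+* GaloisField p m := FiniteField.ringEquivOfCardEq (by
    rw [hcard, ← Nat.card_eq_fintype_card, GaloisField.card p m hm0])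
  obtain ⟨π, hπ⟩ := IsDiscreteValuationRing.exists_irreducible O
  let res : O →+* GaloisField p m := e.toRingHom.comp (Ideal.Quotient.mk _)
  have hres : ∀ a, res a = 0 ↔ a ∈ IsLocalRing.maximalIdeal O := by
    intro a
    simp only [res, RingHom.comp_apply]
    rw [← Ideal.Quotient.eq_zero_iff_mem]
    exact e.map_eq_zero_iff
  obtain ⟨φ, hφ, hφc⟩ := lemA (O := O) (κ := GaloisField p m) p m hm0 π hπ.ne_zero res
    (e.surjective.comp Ideal.Quotient.mk_surjective)
    (fun a => by rw [hres, hπ.maximalIdeal_eq, Ideal.mem_span_singleton])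
    (fun x => by
      have := FiniteField.pow_card x
      rwa [← Nat.card_eq_fintype_card, GaloisField.card p m hm0] at this)
  let ψ : C →+* LaurentSeries (GaloisField p m) :=
    ((HahnSeries.ofPowerSeries ℤ (GaloisField p m)).comp φ).comp (algebraMap C O)
  have hψ : Function.Injective ψ :=
    (HahnSeries.ofPowerSeries_injective.comp hφ).comp hCO
  refine ⟨IsFractionRing.lift hψ, fun x hx => ⟨φ (algebraMap C O x), ?_, ?_⟩⟩
  · rw [hφc, hres]
    exact (IsLocalization.AtPrime.to_map_mem_maximal_iff O Q _).2 hx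
  · rw [IsFractionRing.lift_algebraMap]
    rfl

open Polynomial in
theorem lemB (p : ℕ) [Fact p.Prime] (K L : Type*) [Field K] [Field L] [Algebra (ZMod p)[X] K]
    [IsFractionRing (ZMod p)[X] K] [Algebra K L] [Algebra (ZMod p)[X] L]
    [IsScalarTower (ZMod p)[X] K L] [FiniteDimensional K L] [Algebra.IsSeparable K L] :
    ∃ m : ℕ, m ≠ 0 ∧ ∃ φ : L →+* LaurentSeries (GaloisField p m),
      ∃ Y : PowerSeries (GaloisField p m), PowerSeries.constantCoeff Y = 0 ∧
        φ (algebraMap (ZMod p)[X] L X) = HahnSeries.ofPowerSeries ℤ _ Y := by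
  let A := (ZMod p)[X]
  let C := integralClosure A L
  have hDed : IsDedekindDomain C := integralClosure.isDedekindDomain A K L
  have hFrac : IsFractionRing C L := integralClosure.isFractionRing_of_finite_extension K L
  have hfin : Module.Finite A C := IsIntegralClosure.finite A K L C
  have hAL : Function.Injective (algebraMap A L) := by
    rw [IsScalarTower.algebraMap_eq A K L]
    exact (algebraMap K L).injective.comp (IsFractionRing.injective A K)
  have hAC : Function.Injective (algebraMap A C) := by
    have : algebraMap A L = (algebraMap C L).comp (algebraMap A C) := rfl
    rw [this, RingHom.coe_comp] at hAL
    exact Function.Injective.of_comp hAL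
  let P : Ideal A := Ideal.span {X}
  have hP : P.IsPrime := by
    rw [Ideal.span_singleton_prime X_ne_zero]; exact prime_X
  obtain ⟨Q, hQ, hQP⟩ := Ideal.exists_ideal_over_prime_of_isIntegral_of_isDomain (S := C) P
    (by rw [(RingHom.injective_iff_ker_eq_bot _).1 hAC]; exact bot_le)
  have hover : Q.LiesOver P := ⟨hQP.symm⟩
  have hXQ : algebraMap A C X ∈ Q := by
    rw [← Ideal.mem_comap, hQP]; exact Ideal.mem_span_singleton_self X
  have hQ0 : Q ≠ ⊥ := by
    rintro rfl
    rw [Ideal.mem_bot, map_eq_zero_iff _ hAC] at hXQ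
    exact X_ne_zero hXQ
  have hAP : Finite (A ⧸ P) := by
    refine Finite.of_surjective (fun c : ZMod p => Ideal.Quotient.mk P (Polynomial.C c)) ?_
    intro z
    obtain ⟨f, rfl⟩ := Ideal.Quotient.mk_surjective z
    refine ⟨f.coeff 0, ?_⟩
    rw [Ideal.Quotient.eq, Ideal.mem_span_singleton, X_dvd_iff, coeff_sub, coeff_C_zero, sub_self]
  have hCQ : Finite (C ⧸ Q) := Module.finite_of_finite (A ⧸ P)
  have hcC : CharP C p := charP_of_injective_algebraMap hAC p
  obtain ⟨m, hm, φ, h⟩ := lemB1 p C L Q hQ0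
  exact ⟨m, hm, φ, h _ hXQ⟩

theorem lemC1 (A R Ω : Type*) [CommRing A] [CommRing R] [Field Ω] [IsAlgClosed Ω] [Algebra A R]
    [Algebra.IsIntegral A R] (hinj : Function.Injective (algebraMap A R)) (h : A →+* Ω) :
    ∃ g : R →+* Ω, ∀ a, g (algebraMap A R a) = h a := by
  let P : Ideal A := RingHom.ker h
  have hP : P.IsPrime := RingHom.ker_isPrime h
  obtain ⟨Q, -, hQ, hQP⟩ := Ideal.exists_ideal_over_prime_of_isIntegral (S := R) P ⊥
    (by rw [← RingHom.ker_eq_comap_bot, (RingHom.injective_iff_ker_eq_bot _).1 hinj]; exact bot_le)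
  have hover : Q.LiesOver P := ⟨hQP.symm⟩
  let : Algebra (A ⧸ P) Ω := (RingHom.kerLift h).toAlgebra
  have hi : Function.Injective (algebraMap (A ⧸ P) Ω) := RingHom.kerLift_injective h
  have : FaithfulSMul (A ⧸ P) Ω := (faithfulSMul_iff_algebraMap_injective _ _).2 hi
  have hi2 : Function.Injective (algebraMap (A ⧸ P) (R ⧸ Q)) :=
    FaithfulSMul.algebraMap_injective _ _
  have : Module.IsTorsionFree (A ⧸ P) (R ⧸ Q) :=
    Module.isTorsionFree_iff_algebraMap_injective.2 hi2
  have : Module.IsTorsionFree (A ⧸ P) Ω :=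
    Module.isTorsionFree_iff_algebraMap_injective.2 hi
  have : Algebra.IsIntegral (A ⧸ P) (R ⧸ Q) := inferInstance
  have : Algebra.IsAlgebraic (A ⧸ P) (R ⧸ Q) := inferInstance
  let g : (R ⧸ Q) →ₐ[A ⧸ P] Ω := IsAlgClosed.lift
  refine ⟨g.toRingHom.comp (Ideal.Quotient.mk Q), fun a => ?_⟩
  exact g.commutes (Ideal.Quotient.mk P a)

open Polynomial in
theorem lemC (p : ℕ) [Fact p.Prime] (R : Type*) [CommRing R] [Algebra (ZMod p) R]
    (hfg : Algebra.FiniteType (ZMod p) R) (hdim : 0 < ringKrullDim R) :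
    ∃ (g : R →+* AlgebraicClosure (RatFunc (ZMod p))) (r : R),
      g r * algebraMap (RatFunc (ZMod p)) _ RatFunc.X = 1 := by
  have hnt : Nontrivial R := by
    by_contra h
    rw [not_nontrivial_iff_subsingleton] at h
    rw [ringKrullDim_eq_bot_of_subsingleton] at hdim
    exact absurd hdim (by simp)
  obtain ⟨s, f, hf, hint⟩ := exists_integral_inj_algHom_of_fg (ZMod p) R
  let : Algebra (MvPolynomial (Fin s) (ZMod p)) R := f.toRingHom.toAlgebra
  have hInt : Algebra.IsIntegral (MvPolynomial (Fin s) (ZMod p)) R := ⟨hint⟩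
  have hs : s ≠ 0 := by
    rintro rfl
    have hfield : IsField (MvPolynomial (Fin 0) (ZMod p)) :=
      (MvPolynomial.isEmptyRingEquiv (ZMod p) (Fin 0)).toMulEquiv.isField
        (Field.toIsField (ZMod p))
    let := hfield.toField
    have : Ring.KrullDimLE 0 R := by
      rw [Ring.krullDimLE_zero_iff]
      intro I hI
      refine Ideal.isMaximal_of_isIntegral_of_isMaximal_comap
        (R := MvPolynomial (Fin 0) (ZMod p)) I ?_
      have hp : (I.comap (algebraMap (MvPolynomial (Fin 0) (ZMod p)) R)).IsPrime :=
        Ideal.comap_isPrime _ _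
      have := (Ideal.eq_bot_or_top
        (I.comap (algebraMap (MvPolynomial (Fin 0) (ZMod p)) R))).resolve_right hp.ne_top
      rw [this]
      exact Ideal.bot_isMaximal
    have h2 := (Ring.krullDimLE_iff (n := 0) (R := R)).1 this
    exact absurd hdim (not_lt.2 (by exact_mod_cast h2))
  let y : AlgebraicClosure (RatFunc (ZMod p)) := algebraMap (RatFunc (ZMod p)) _ RatFunc.X
  have hy : y ≠ 0 := by
    simp only [y]
    rw [Ne, map_eq_zero]
    exact RatFunc.X_ne_zero
  obtain ⟨g, hg⟩ := lemC1 (MvPolynomial (Fin s) (ZMod p)) R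
    (AlgebraicClosure (RatFunc (ZMod p))) hf
    (MvPolynomial.eval₂Hom (algebraMap (ZMod p) _) (fun _ => y⁻¹))
  refine ⟨g, algebraMap (MvPolynomial (Fin s) (ZMod p)) R
    (MvPolynomial.X ⟨0, Nat.pos_of_ne_zero hs⟩), ?_⟩
  rw [hg, MvPolynomial.eval₂Hom_X']
  exact inv_mul_cancel₀ hy

open Polynomial in
theorem stmt12Aux (p : ℕ) [Fact p.Prime] (R : Type*) [CommRing R] [Algebra (ZMod p) R]
    (hfg : Algebra.FiniteType (ZMod p) R) (hdim : 0 < ringKrullDim R) :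
    ∃ (m : ℕ), m ≠ 0 ∧
      ∃ φ : R →ₐ[ZMod p] LaurentSeries (GaloisField p m),
        ∃ r : R, φ r ∉ Set.range (HahnSeries.ofPowerSeries ℤ (GaloisField p m)) := by
  obtain ⟨g, r, hr⟩ := lemC p R hfg hdim
  let K := RatFunc (ZMod p)
  let Ω := AlgebraicClosure K
  have hcK : CharP K p := charP_of_injective_algebraMap
    (IsFractionRing.injective (ZMod p)[X] K) p
  have hcΩ : CharP Ω p := charP_of_injective_algebraMap (algebraMap K Ω).injective p
  have hpp : p.Prime := Fact.out
  have : ExpChar K p := ExpChar.prime hpp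
  have : ExpChar Ω p := ExpChar.prime hpp
  have : ExpChar (separableClosure K Ω) p := 
    expChar_of_injective_algebraMap (algebraMap K (separableClosure K Ω)).injective p
  obtain ⟨S, hS⟩ := hfg.out
  have hpow : ∀ x : Ω, ∃ n : ℕ, x ^ p ^ n ∈ separableClosure K Ω := by
    intro x
    obtain ⟨n, ⟨z, hz⟩⟩ := IsPurelyInseparable.pow_mem (separableClosure K Ω) p x
    exact ⟨n, by rw [← hz]; exact z.2⟩
  choose N hN using hpow
  let e := S.sup (fun s => N (g s))
  have he : ∀ s ∈ S, (g s) ^ p ^ e ∈ separableClosure K Ω := by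
    intro s hs
    obtain ⟨k, hk⟩ := Nat.exists_eq_add_of_le (Finset.le_sup (f := fun s => N (g s)) hs)
    have : e = N (g s) + k := hk
    rw [this, pow_add, pow_mul]
    exact pow_mem (hN _) _
  let T : Set Ω := (fun s => (g s) ^ p ^ e) '' (S : Set R)
  have hTfin : T.Finite := S.finite_toSet.image _
  let L : IntermediateField K Ω := IntermediateField.adjoin K T
  have : Finite T := hTfin
  have hLfd : FiniteDimensional K L :=
    IntermediateField.finiteDimensional_adjoin (fun x _ => Algebra.IsIntegral.isIntegral x)
  have hLsep : Algebra.IsSeparable K L := by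
    rw [IntermediateField.isSeparable_adjoin_iff_isSeparable]
    rintro _ ⟨s, hs, rfl⟩
    exact mem_separableClosure_iff.1 (he s hs)
  let ψ : R →+* Ω := (iterateFrobenius Ω p e).comp g
  have hψ : ∀ a, ψ a ∈ L := by
    intro a
    have ha : a ∈ Algebra.adjoin (ZMod p) (S : Set R) := by rw [hS]; trivial
    induction ha using Algebra.adjoin_induction with
    | mem x hx =>
      exact IntermediateField.subset_adjoin K T ⟨x, hx, by simp [ψ, iterateFrobenius_def]⟩
    | algebraMap c =>
      rw [← ZMod.natCast_zmod_val c, map_natCast, map_natCast]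
      exact natCast_mem L _
    | add x y _ _ hx hy => rw [map_add]; exact add_mem hx hy
    | mul x y _ _ hx hy => rw [map_mul]; exact mul_mem hx hy
  let ψ' : R →+* L := ψ.codRestrict L hψ
  obtain ⟨m, hm, φ, Y, hY, hφ⟩ := lemB p K L
  have hrel : ψ' r * (algebraMap (ZMod p)[X] L X) ^ p ^ e = 1 := by
    apply Subtype.ext
    have h1 : ((algebraMap (ZMod p)[X] L X : L) : Ω) = algebraMap K Ω RatFunc.X := by
      rw [← RatFunc.algebraMap_X]; rfl
    push_cast
    rw [h1]
    change iterateFrobenius Ω p e (g r) * _ = 1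
    rw [iterateFrobenius_def, ← mul_pow, hr, one_pow]
  let Φ := φ.comp ψ'
  refine ⟨m, hm, ⟨Φ, fun c => ?_⟩, r, ?_⟩
  · change (Φ.comp (algebraMap (ZMod p) R)) c = _
    rw [Subsingleton.elim (Φ.comp (algebraMap (ZMod p) R)) (algebraMap (ZMod p) _)]
  · rintro ⟨Z, hZ⟩
    have h2 := congrArg φ hrel
    rw [map_mul, map_pow, hφ, map_one] at h2
    have h3 : HahnSeries.ofPowerSeries ℤ (GaloisField p m) Z = φ (ψ' r) := hZ
    rw [← h3, ← map_pow, ← map_mul, ← map_one (HahnSeries.ofPowerSeries ℤ _)] at h2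
    have h4 := congrArg PowerSeries.constantCoeff (HahnSeries.ofPowerSeries_injective h2)
    rw [map_mul, map_pow, hY, zero_pow (pow_ne_zero _ hpp.ne_zero), mul_zero, map_one] at h4
    exact zero_ne_one h4


/-- let `M = Spec R` be an affine scheme of finite type over `𝔽_p`
(`R` a finitely generated `ZMod p`-algebra) of positive dimension. Then there is a power
`q = p^m` of `p` and a point of `M` with values in the local field `𝔽_q((t))` (a `ZMod p`-
algebra homomorphism `R → 𝔽_q((t))`) that does not extend to a point with values in the
valuation ring `𝔽_q[[t]]`, i.e. some value is not a power series. -/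
theorem stmt12 (p : ℕ) [Fact p.Prime] (R : Type*) [CommRing R] [Algebra (ZMod p) R]
    (hfg : Algebra.FiniteType (ZMod p) R) (hdim : 0 < ringKrullDim R) :
    ∃ (m : ℕ), m ≠ 0 ∧
      ∃ φ : R →ₐ[ZMod p] LaurentSeries (GaloisField p m),
        ∃ r : R, φ r ∉ Set.range (HahnSeries.ofPowerSeries ℤ (GaloisField p m)) := by
  exact stmt12Aux p R hfg hdim
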